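/- Let H be a Hilbert space, E_μ a generalized spectral family on H (0 ≤ E_{μ₁} ≤ E_{μ₂} ≤ I for μ₁ < μ₂, E_{-∞} = 0, left-continuous), and define R(λ) = ∫_ℝ dE_μ/(μ−λ) for Im λ ≠ 0. Then R satisfies: (a) R(λ)* = R(λ̄); (b) ‖R(λ)f‖² ≤ Im(R(λ)f,f)/Im λ for all f ∈ H, Im λ ≠ 0. -/

import Mathlib

open MeasureTheory Filter ContinuousLinearMap
open scoped ComplexInnerProductSpace

/-- Riemann sums over the grid of mesh `1 / n` on `(-n - 1 / n, n]` converge to the integral of a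
bounded continuous function. -/
theorem tendsto_sum_measureReal_Ioc_smul {F : Type*} [NormedAddCommGroup F] [NormedSpace ℝ F]
    [CompleteSpace F]
    (μ : Measure ℝ) [IsFiniteMeasure μ] {ψ : ℝ → F} (hψ : Continuous ψ) {C : ℝ}
    (hC : ∀ x, ‖ψ x‖ ≤ C) :
    Tendsto (fun n : ℕ => ∑ k ∈ Finset.Icc (-(n : ℤ) ^ 2) ((n : ℤ) ^ 2),
      μ.real (Set.Ioc (((k : ℝ) - 1) / n) ((k : ℝ) / n)) • ψ ((k : ℝ) / n)) atTop
      (nhds (∫ x, ψ x ∂μ)) := by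
  have hC0 : 0 ≤ C := (norm_nonneg _).trans (hC 0)
  set step : ℕ → ℝ → F := fun n x => ∑ k ∈ Finset.Icc (-(n : ℤ) ^ 2) ((n : ℤ) ^ 2),
    (Set.Ioc (((k : ℝ) - 1) / n) ((k : ℝ) / n)).indicator (fun _ => ψ ((k : ℝ) / n)) x with hstep
  have hintegral : ∀ n : ℕ, ∫ x, step n x ∂μ = ∑ k ∈ Finset.Icc (-(n : ℤ) ^ 2) ((n : ℤ) ^ 2),
      μ.real (Set.Ioc (((k : ℝ) - 1) / n) ((k : ℝ) / n)) • ψ ((k : ℝ) / n) := by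
    intro n
    rw [hstep]
    simp only
    rw [integral_finsetSum _ fun k _ => (integrable_const _).indicator measurableSet_Ioc]
    exact Finset.sum_congr rfl fun k _ => integral_indicator_const _ measurableSet_Ioc
  have hval : ∀ n : ℕ, 0 < n → ∀ x : ℝ, step n x =
      if ⌈x * n⌉ ∈ Finset.Icc (-(n : ℤ) ^ 2) ((n : ℤ) ^ 2) then ψ ((⌈x * n⌉ : ℝ) / n) else 0 := by
    intro n hn x
    have hn' : (0 : ℝ) < n := by exact_mod_cast hn
    rw [← Finset.sum_ite_eq' (Finset.Icc (-(n : ℤ) ^ 2) ((n : ℤ) ^ 2)) ⌈x * n⌉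
      (fun k => ψ ((k : ℝ) / n))]
    refine Finset.sum_congr rfl fun k _ => ?_
    rw [Set.indicator_apply]
    refine if_congr ?_ rfl rfl
    rw [Set.mem_Ioc, div_lt_iff₀ hn', le_div_iff₀ hn', eq_comm, Int.ceil_eq_iff]
  simp_rw [← hintegral]
  refine tendsto_integral_filter_of_dominated_convergence (fun _ => C) ?_ ?_
    (integrable_const C) ?_
  · refine .of_forall fun n => Finset.aestronglyMeasurable_fun_sum _ fun k _ => ?_
    exact aestronglyMeasurable_const.indicator measurableSet_Ioc
  · filter_upwards [eventually_gt_atTop 0] with n hn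
    refine .of_forall fun x => ?_
    rw [hval n hn]
    split_ifs
    · exact hC _
    · simpa using hC0
  · refine .of_forall fun x => ?_
    have hlim : Tendsto (fun n : ℕ => (⌈x * n⌉ : ℝ) / n) atTop (nhds x) := by
      have hup : Tendsto (fun n : ℕ => x + 1 / (n : ℝ)) atTop (nhds x) := by
        simpa using tendsto_one_div_atTop_nhds_zero_nat.const_add x
      refine tendsto_of_tendsto_of_tendsto_of_le_of_le' tendsto_const_nhds hup ?_ ?_
      all_goals
        filter_upwards [eventually_gt_atTop 0] with n hn
        have hn' : (0 : ℝ) < n := by exact_mod_cast hn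
      · rw [le_div_iff₀ hn']
        exact Int.le_ceil _
      · rw [div_le_iff₀ hn', add_mul, one_div_mul_cancel hn'.ne']
        exact (Int.ceil_lt_add_one _).le
    refine ((hψ.tendsto x).comp hlim).congr' ?_
    filter_upwards [eventually_gt_atTop 0, eventually_ge_atTop ⌈|x|⌉₊] with n hn hnx
    have hx : |x| ≤ n := Nat.ceil_le.1 hnx
    have hn' : (0 : ℝ) < n := by exact_mod_cast hn
    have ⟨h1, h2⟩ := abs_le.1 hx
    rw [hval n hn, if_pos, Function.comp_apply]
    rw [Finset.mem_Icc]
    constructor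
    · have : ((-(n : ℤ) ^ 2 : ℤ) : ℝ) ≤ ⌈x * n⌉ := by
        refine le_trans ?_ (Int.le_ceil _)
        push_cast
        nlinarith
      exact_mod_cast this
    · rw [Int.ceil_le]
      push_cast
      nlinarith

/-- Cauchy–Schwarz inequality for a finite combination of positive operators. -/
theorem norm_inner_sum_smul_sq_le {ι H : Type*} [NormedAddCommGroup H] [InnerProductSpace ℂ H]
    [CompleteSpace H] (s : Finset ι) (P : ι → H →L[ℂ] H) (hP : ∀ i, (P i).IsPositive) (c : ι → ℂ)
    (f g : H) :
    ‖⟪g, (∑ i ∈ s, c i • P i) f⟫‖ ^ 2 ≤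
      (∑ i ∈ s, (⟪g, P i g⟫).re) * ∑ i ∈ s, (⟪f, P i f⟫).re * ‖c i‖ ^ 2 := by
  set S : ι → H →L[ℂ] H := fun i => CFC.sqrt (P i)
  have hS : ∀ i x y, ⟪x, P i y⟫ = ⟪S i x, S i y⟫ := by
    intro i x y
    have hadj : ContinuousLinearMap.adjoint (S i) = S i :=
      (IsSelfAdjoint.of_nonneg (CFC.sqrt_nonneg (P i))).adjoint_eq
    have hmul : S i * S i = P i :=
      CFC.sqrt_mul_sqrt_self (P i) ((nonneg_iff_isPositive _).2 (hP i))
    rw [← ContinuousLinearMap.adjoint_inner_right, hadj, ← hmul]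
    rfl
  have hre : ∀ i x, (⟪x, P i x⟫).re = ‖S i x‖ ^ 2 := by
    intro i x
    rw [hS]
    exact inner_self_eq_norm_sq (𝕜 := ℂ) _
  have hle : ‖⟪g, (∑ i ∈ s, c i • P i) f⟫‖ ≤ ∑ i ∈ s, ‖S i g‖ * (‖S i f‖ * ‖c i‖) := by
    rw [sum_apply, inner_sum]
    refine (norm_sum_le _ _).trans (Finset.sum_le_sum fun i _ => ?_)
    rw [smul_apply, inner_smul_right, norm_mul, hS, ← mul_assoc, mul_comm]
    gcongr
    exact norm_inner_le_norm _ _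
  calc ‖⟪g, (∑ i ∈ s, c i • P i) f⟫‖ ^ 2
      ≤ (∑ i ∈ s, ‖S i g‖ * (‖S i f‖ * ‖c i‖)) ^ 2 := by gcongr
    _ ≤ _ := Finset.sum_mul_sq_le_sq_mul_sq _ _ _
    _ = _ := by simp only [hre, mul_pow]

/-- Convergence of quadratic forms implies convergence of the associated sesquilinear forms. -/
theorem tendsto_inner_of_tendsto_inner_self {ι H : Type*} [NormedAddCommGroup H]
    [InnerProductSpace ℂ H] {l : Filter ι} {T : ι → H →L[ℂ] H} {A : H →L[ℂ] H}
    (h : ∀ f, Tendsto (fun i => ⟪f, T i f⟫) l (nhds ⟪f, A f⟫)) (f g : H) :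
    Tendsto (fun i => ⟪g, T i f⟫) l (nhds ⟪g, A f⟫) := by
  have h' : ∀ f, Tendsto (fun i => ⟪T i f, f⟫) l (nhds ⟪A f, f⟫) := by
    intro f
    simpa only [Function.comp_def, inner_conj_symm] using
      (Complex.continuous_conj.tendsto _).comp (h f)
  have hpol : Tendsto (fun i => ⟪T i f, g⟫) l (nhds ⟪A f, g⟫) := by
    have e : ∀ B : H →L[ℂ] H, ⟪B f, g⟫ = _ := fun B => inner_map_polarization (B : H →ₗ[ℂ] H) g f
    simp only [e]
    exact ((((h' _).sub (h' _)).add ((h' _).const_mul _)).sub ((h' _).const_mul _)).div_const 4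
  simpa only [Function.comp_def, inner_conj_symm] using
    (Complex.continuous_conj.tendsto _).comp hpol

theorem ofReal_sub_ne_zero_of_im_ne_zero {l : ℂ} (hl : l.im ≠ 0) (x : ℝ) : (x : ℂ) - l ≠ 0 := by
  intro h
  exact hl (by simpa using congrArg Complex.im h)

theorem norm_inv_ofReal_sub_le {l : ℂ} (hl : l.im ≠ 0) (x : ℝ) :
    ‖((x : ℂ) - l)⁻¹‖ ≤ |l.im|⁻¹ := by
  rw [norm_inv]
  refine inv_anti₀ (abs_pos.2 hl) ?_
  simpa using Complex.abs_im_le_norm ((x : ℂ) - l)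

theorem continuous_inv_ofReal_sub {l : ℂ} (hl : l.im ≠ 0) :
    Continuous fun x : ℝ => ((x : ℂ) - l)⁻¹ :=
  (Complex.continuous_ofReal.sub continuous_const).inv₀ (ofReal_sub_ne_zero_of_im_ne_zero hl)

/-- The imaginary part of a Cauchy transform of a finite measure. -/
theorem im_integral_inv_ofReal_sub (μ : Measure ℝ) [IsFiniteMeasure μ] {l : ℂ} (hl : l.im ≠ 0) :
    (∫ x : ℝ, ((x : ℂ) - l)⁻¹ ∂μ).im / l.im = ∫ x : ℝ, ‖((x : ℂ) - l)⁻¹‖ ^ 2 ∂μ := by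
  have hintegral : Integrable (fun x : ℝ => ((x : ℂ) - l)⁻¹) μ :=
    .of_bound (continuous_inv_ofReal_sub hl).aestronglyMeasurable _
      (.of_forall (norm_inv_ofReal_sub_le hl))
  have him : (∫ x : ℝ, ((x : ℂ) - l)⁻¹ ∂μ).im = ∫ x : ℝ, (((x : ℂ) - l)⁻¹).im ∂μ :=
    (integral_im hintegral).symm
  rw [him, ← integral_div]
  refine integral_congr_ae (.of_forall fun x => ?_)
  simp only [Complex.inv_im, norm_inv, inv_pow, ← Complex.normSq_eq_norm_sq]
  simp only [Complex.sub_im, Complex.ofReal_im, zero_sub, neg_neg]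
  field_simp

/-- The Cauchy transform `R(λ) = ∫ dE_μ/(μ-λ)` of a generalized spectral family
satisfies (a) `R(λ)* = R(λ̄)` and (b) `‖R(λ)f‖² ≤ Im(R(λ)f,f)/Im λ` for nonreal `λ`. -/
theorem stmt_3
    {H : Type*} [NormedAddCommGroup H] [InnerProductSpace ℂ H] [CompleteSpace H]
    (E : ℝ → H →L[ℂ] H)
    (hpos : ∀ μ, (E μ).IsPositive)
    (hle1 : ∀ μ, ((1 : H →L[ℂ] H) - E μ).IsPositive)
    (hmono : ∀ μ₁ μ₂ : ℝ, μ₁ ≤ μ₂ → (E μ₂ - E μ₁).IsPositive)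
    (hbot : ∀ f : H, Tendsto (fun μ => E μ f) atBot (nhds 0))
    (ν : H → Measure ℝ)
    (hνfin : ∀ f, IsFiniteMeasure (ν f))
    (hν : ∀ (f : H) (μ : ℝ), ((ν f) (Set.Iic μ)).toReal = (⟪f, E μ f⟫).re)
    (R : ℂ → H →L[ℂ] H)
    (hR : ∀ l : ℂ, l.im ≠ 0 → ∀ f : H,
      ⟪f, R l f⟫ = ∫ μ : ℝ, ((μ : ℂ) - l)⁻¹ ∂(ν f)) :
    (∀ l : ℂ, l.im ≠ 0 → ContinuousLinearMap.adjoint (R l) = R ((starRingEnd ℂ) l)) ∧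
    (∀ l : ℂ, l.im ≠ 0 → ∀ f : H, ‖R l f‖ ^ 2 ≤ (⟪f, R l f⟫).im / l.im) := by
  have hself : ∀ P : H →L[ℂ] H, P.IsPositive → ∀ f, ⟪f, P f⟫ = ((⟪f, P f⟫).re : ℂ) := by
    intro P hP f
    exact (Complex.eq_re_of_ofReal_le (r := 0) (by simpa using hP.inner_nonneg_right f))
  have hIoc : ∀ f (a b : ℝ), a ≤ b → (⟪f, (E b - E a) f⟫).re = (ν f).real (Set.Ioc a b) := by
    intro f a b hab
    have := hνfin f
    rw [← Set.Iic_sdiff_Iic, measureReal_sdiff (Set.Iic_subset_Iic.2 hab) measurableSet_Iic,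
      measureReal_def, measureReal_def, hν, hν, sub_apply, inner_sub_right,
      Complex.sub_re]
  have hmass : ∀ f, (ν f).real Set.univ ≤ ‖f‖ ^ 2 := by
    intro f
    have := hνfin f
    refine le_of_tendsto ((ENNReal.tendsto_toReal (measure_ne_top _ _)).comp
      (tendsto_measure_Iic_atTop (ν f))) (.of_forall fun μ => ?_)
    have h := (hle1 μ).re_inner_nonneg_right f
    rw [sub_apply, inner_sub_right, map_sub, one_apply_eq_self,
      inner_self_eq_norm_sq] at h
    rw [Function.comp_apply, hν]
    exact sub_nonneg.1 h
  refine ⟨fun l hl => ?_, fun l hl f => ?_⟩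
  · have hl' : ((starRingEnd ℂ) l).im ≠ 0 := by simpa using hl
    refine ContinuousLinearMap.coe_injective ((ext_inner_map _ _).1 fun f => ?_)
    change ⟪ContinuousLinearMap.adjoint (R l) f, f⟫ = ⟪R ((starRingEnd ℂ) l) f, f⟫
    rw [ContinuousLinearMap.adjoint_inner_left, ← inner_conj_symm (R _ f), hR _ hl, hR _ hl',
      ← integral_conj]
    simp
  · have := hνfin
    set φ : ℝ → ℂ := fun x => ((x : ℂ) - l)⁻¹
    have hφ : Continuous φ := continuous_inv_ofReal_sub hl
    have hφC : ∀ x, ‖φ x‖ ≤ |l.im|⁻¹ := norm_inv_ofReal_sub_le hl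
    set s : ℕ → Finset ℤ := fun n => Finset.Icc (-(n : ℤ) ^ 2) ((n : ℤ) ^ 2)
    set P : ℕ → ℤ → H →L[ℂ] H := fun n k => E ((k : ℝ) / n) - E (((k : ℝ) - 1) / n)
    have hgrid : ∀ (n : ℕ) (k : ℤ), ((k : ℝ) - 1) / n ≤ (k : ℝ) / n := by
      intro n k
      gcongr
      linarith
    have hP : ∀ n k, (P n k).IsPositive := fun n k => hmono _ _ (hgrid n k)
    have hPν : ∀ n k f, (⟪f, P n k f⟫).re =
        (ν f).real (Set.Ioc (((k : ℝ) - 1) / n) ((k : ℝ) / n)) :=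
      fun n k f => hIoc f _ _ (hgrid n k)
    set T : ℕ → H →L[ℂ] H := fun n => ∑ k ∈ s n, φ ((k : ℝ) / n) • P n k
    have hT : ∀ f, Tendsto (fun n => ⟪f, T n f⟫) atTop (nhds ⟪f, R l f⟫) := by
      intro f
      rw [hR l hl]
      refine (tendsto_sum_measureReal_Ioc_smul (ν f) hφ hφC).congr fun n => ?_
      rw [sum_apply, inner_sum]
      refine Finset.sum_congr rfl fun k _ => ?_
      rw [smul_apply, inner_smul_right, hself _ (hP n k), hPν,
        Complex.real_smul, mul_comm]
    have hlim₁ := (tendsto_inner_of_tendsto_inner_self hT f (R l f)).norm.pow 2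
    have hlim₂ := tendsto_sum_measureReal_Ioc_smul (ν (R l f)) (ψ := fun _ => (1 : ℝ))
      continuous_const (C := 1) (by simp)
    have hlim₃ := tendsto_sum_measureReal_Ioc_smul (ν f) (ψ := fun x => ‖φ x‖ ^ 2)
      (hφ.norm.pow 2) (C := (|l.im|⁻¹) ^ 2) (fun x => by
        rw [Real.norm_of_nonneg (by positivity)]
        gcongr
        exact hφC x)
    have hle := le_of_tendsto_of_tendsto' hlim₁ (hlim₂.mul hlim₃) fun n => by
      simpa only [hPν, smul_eq_mul, mul_one] using
        norm_inner_sum_smul_sq_le (s n) (P n) (hP n) (fun k => φ ((k : ℝ) / n)) f (R l f)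
    rw [hR l hl, im_integral_inv_ofReal_sub _ hl]
    have hI : 0 ≤ ∫ x, ‖φ x‖ ^ 2 ∂(ν f) := integral_nonneg fun x => by positivity
    rw [integral_const, smul_eq_mul, mul_one, inner_self_eq_norm_sq_to_K] at hle
    have hle' : (‖R l f‖ ^ 2) ^ 2 ≤ ‖R l f‖ ^ 2 * ∫ x, ‖φ x‖ ^ 2 ∂(ν f) := by
      refine le_trans (le_of_eq ?_) (hle.trans (mul_le_mul_of_nonneg_right (hmass _) hI))
      simp
    rcases (sq_nonneg ‖R l f‖).eq_or_lt with h0 | h0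
    · rw [← h0]
      exact hI
    · rw [sq (‖R l f‖ ^ 2)] at hle'
      exact le_of_mul_le_mul_left hle' h0
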